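/- arXiv:0909.1797 — 4 statements merged into one kernel-verified Lean document; each statement's English description precedes it below -/
import Mathlib

section
/- Let Ω ⊆ ℝ^m be open, c : Ω → L(ℝ^m, End_ℂ(ℂⁿ)) a smooth trivialized linear connection, X, X' : Ω → ℝ^m smooth vector fields, and A, A' : Ω → End_ℂ(ℂⁿ) smooth. Set Y_c(x,u) = (X x, (c x (X x) + A x) u) and Y'_c(x,u) = (X' x, (c x (X' x) + A' x) u). Then the fiber coefficient of the Lie bracket [Y_c, Y'_c] at x, after subtracting the horizontal contribution c x ([X,X'] x), equals −R x (X x, X' x) + (∇_X A')(x) − (∇_{X'} A)(x) + [A' x, A x], where R is the curvature of c, ∇ is the covariant derivative induced by c on End-valued maps, and [·,·] is the commutator of endomorphisms. Equivalently, [Y_c, Y'_c](x,u) = ( [X,X'](x) , ( c x ([X,X'] x) − R x (X x, X' x) + (∇_X A')(x) − (∇_{X'} A)(x) + [A' x, A x] ) u ). -/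
noncomputable section

/-- The curvature of a trivialized linear connection
`c : Ω → L(ℝ^m, End_ℂ(ℂⁿ))`:
`R x (v, w) = −(Dc(x)v)(w) + (Dc(x)w)(v) + c x v ∘ c x w − c x w ∘ c x v`. -/
def curv {m n : ℕ}
    (c : EuclideanSpace ℝ (Fin m) →
      (EuclideanSpace ℝ (Fin m) →L[ℝ]
        (EuclideanSpace ℂ (Fin n) →L[ℂ] EuclideanSpace ℂ (Fin n))))
    (x v w : EuclideanSpace ℝ (Fin m)) :
    EuclideanSpace ℂ (Fin n) →L[ℂ] EuclideanSpace ℂ (Fin n) :=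
  -(fderiv ℝ c x v w) + fderiv ℝ c x w v + (c x v).comp (c x w) - (c x w).comp (c x v)

/-- The covariant derivative `(∇_X A)(x) = DA(x)(X x) − [c x (X x), A x]` of an
`End`-valued map along a vector field. -/
def covd {m n : ℕ}
    (c : EuclideanSpace ℝ (Fin m) →
      (EuclideanSpace ℝ (Fin m) →L[ℝ]
        (EuclideanSpace ℂ (Fin n) →L[ℂ] EuclideanSpace ℂ (Fin n))))
    (X : EuclideanSpace ℝ (Fin m) → EuclideanSpace ℝ (Fin m))
    (A : EuclideanSpace ℝ (Fin m) →
      (EuclideanSpace ℂ (Fin n) →L[ℂ] EuclideanSpace ℂ (Fin n)))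
    (x : EuclideanSpace ℝ (Fin m)) :
    EuclideanSpace ℂ (Fin n) →L[ℂ] EuclideanSpace ℂ (Fin n) :=
  fderiv ℝ A x (X x) - ((c x (X x)).comp (A x) - (A x).comp (c x (X x)))

/-- The Hermitian-type vector field `Y_c (x, u) = (X x, (c x (X x) + A x) u)` on `Ω × ℂⁿ`
determined by the connection `c`, the vector field `X` and the coefficient `A`. -/
def connVF {m n : ℕ}
    (c : EuclideanSpace ℝ (Fin m) →
      (EuclideanSpace ℝ (Fin m) →L[ℝ]
        (EuclideanSpace ℂ (Fin n) →L[ℂ] EuclideanSpace ℂ (Fin n))))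
    (X : EuclideanSpace ℝ (Fin m) → EuclideanSpace ℝ (Fin m))
    (A : EuclideanSpace ℝ (Fin m) →
      (EuclideanSpace ℂ (Fin n) →L[ℂ] EuclideanSpace ℂ (Fin n))) :
    EuclideanSpace ℝ (Fin m) × EuclideanSpace ℂ (Fin n) →
      EuclideanSpace ℝ (Fin m) × EuclideanSpace ℂ (Fin n) :=
  fun p => (X p.1, (c p.1 (X p.1) + A p.1) p.2)

/-- The Fréchet derivative of `connVF c X A` at a point of the total space. -/
theorem fderiv_connVF_apply {m n : ℕ}
    {c : EuclideanSpace ℝ (Fin m) →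
      (EuclideanSpace ℝ (Fin m) →L[ℝ]
        (EuclideanSpace ℂ (Fin n) →L[ℂ] EuclideanSpace ℂ (Fin n)))}
    {X : EuclideanSpace ℝ (Fin m) → EuclideanSpace ℝ (Fin m)}
    {A : EuclideanSpace ℝ (Fin m) →
      (EuclideanSpace ℂ (Fin n) →L[ℂ] EuclideanSpace ℂ (Fin n))}
    {x : EuclideanSpace ℝ (Fin m)}
    (hc : DifferentiableAt ℝ c x) (hX : DifferentiableAt ℝ X x) (hA : DifferentiableAt ℝ A x)
    (u : EuclideanSpace ℂ (Fin n)) (v : EuclideanSpace ℝ (Fin m)) (w : EuclideanSpace ℂ (Fin n)) :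
    fderiv ℝ (connVF c X A) (x, u) (v, w) =
      (fderiv ℝ X x v,
        (fderiv ℝ c x v (X x) + c x (fderiv ℝ X x v) + fderiv ℝ A x v) u
          + (c x (X x) + A x) w) := by
  have hfst : HasFDerivAt (Prod.fst : EuclideanSpace ℝ (Fin m) × EuclideanSpace ℂ (Fin n) → _)
      (ContinuousLinearMap.fst ℝ _ _) (x, u) := hasFDerivAt_fst
  have hsnd : HasFDerivAt (Prod.snd : EuclideanSpace ℝ (Fin m) × EuclideanSpace ℂ (Fin n) → _)
      (ContinuousLinearMap.snd ℝ _ _) (x, u) := hasFDerivAt_snd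
  have hB := (hc.hasFDerivAt.clm_apply hX.hasFDerivAt).add hA.hasFDerivAt
  have hR := (ContinuousLinearMap.restrictScalarsL ℂ (EuclideanSpace ℂ (Fin n))
    (EuclideanSpace ℂ (Fin n)) ℝ ℝ).hasFDerivAt.comp x hB
  have hF := (HasFDerivAt.comp (x, u) (f := Prod.fst) hX.hasFDerivAt hfst).prodMk
    ((HasFDerivAt.comp (x, u) (f := Prod.fst) hR hfst).clm_apply hsnd)
  have h : HasFDerivAt (connVF c X A) _ (x, u) := hF
  rw [h.fderiv]
  ext i
  · simp
  · simp
    ring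

/-- The Lie bracket of `Y_c = X ⌟ c + A` and `Y'_c = X' ⌟ c + A'` is
`[Y_c, Y'_c](x, u) = ([X, X'] x, (c x ([X,X'] x) − R x (X x, X' x) + (∇_X A')(x) −
(∇_{X'} A)(x) + [A' x, A x]) u)`; i.e. subtracting the horizontal contribution
`c x ([X, X'] x)` from the fiber coefficient leaves
`−R(X, X') + ∇_X A' − ∇_{X'} A + [A', A]`. -/
theorem bracket_of_connVF {m n : ℕ}
    (Ω : Set (EuclideanSpace ℝ (Fin m))) (hΩ : IsOpen Ω)
    (c : EuclideanSpace ℝ (Fin m) →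
      (EuclideanSpace ℝ (Fin m) →L[ℝ]
        (EuclideanSpace ℂ (Fin n) →L[ℂ] EuclideanSpace ℂ (Fin n))))
    (hc : ContDiffOn ℝ (⊤ : ℕ∞) c Ω)
    (X X' : EuclideanSpace ℝ (Fin m) → EuclideanSpace ℝ (Fin m))
    (A A' : EuclideanSpace ℝ (Fin m) →
      (EuclideanSpace ℂ (Fin n) →L[ℂ] EuclideanSpace ℂ (Fin n)))
    (hX : ContDiffOn ℝ (⊤ : ℕ∞) X Ω) (hX' : ContDiffOn ℝ (⊤ : ℕ∞) X' Ω)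
    (hA : ContDiffOn ℝ (⊤ : ℕ∞) A Ω) (hA' : ContDiffOn ℝ (⊤ : ℕ∞) A' Ω) :
    ∀ x ∈ Ω, ∀ u : EuclideanSpace ℂ (Fin n),
      fderiv ℝ (connVF c X' A') (x, u) (connVF c X A (x, u))
          - fderiv ℝ (connVF c X A) (x, u) (connVF c X' A' (x, u))
        = (fderiv ℝ X' x (X x) - fderiv ℝ X x (X' x),
           (c x (fderiv ℝ X' x (X x) - fderiv ℝ X x (X' x))
             - curv c x (X x) (X' x)
             + covd c X A' x - covd c X' A x
             + ((A' x).comp (A x) - (A x).comp (A' x))) u) := by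
  intro x hx u
  have hd {F : Type} [NormedAddCommGroup F] [NormedSpace ℝ F] {f : EuclideanSpace ℝ (Fin m) → F}
      (hf : ContDiffOn ℝ (⊤ : ℕ∞) f Ω) : DifferentiableAt ℝ f x :=
    (hf.contDiffAt (hΩ.mem_nhds hx)).differentiableAt (by simp)
  rw [fderiv_connVF_apply (hd hc) (hd hX') (hd hA'),
    fderiv_connVF_apply (hd hc) (hd hX) (hd hA)]
  refine Prod.ext rfl ?_
  simp only [connVF, curv, covd, Prod.snd_sub, map_sub, map_add, add_apply, sub_apply,
    neg_apply, ContinuousLinearMap.comp_apply]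
  abel
end
end

section
/- Let Ω ⊆ ℝ^m be open, c : Ω → L(ℝ^m, End_ℂ(ℂⁿ)) a smooth trivialized linear connection, and X, X' : Ω → ℝ^m smooth vector fields with horizontal lifts Xᶜ(x,u) = (X x, c x (X x) u) and X'ᶜ(x,u) = (X' x, c x (X' x) u). Then the Lie bracket of the lifts satisfies [Xᶜ, X'ᶜ](x,u) = ( [X,X'](x) , ( c x ([X,X'] x) − R x (X x, X' x) ) u ); in other words, the vertical defect of [Xᶜ, X'ᶜ] from the horizontal lift of [X,X'] is given by (minus) the curvature of c evaluated on X and X'. -/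
noncomputable section

/-- The horizontal lift `Xᶜ (x, u) = (X x, c x (X x) u)` of a vector field `X` via the
trivialized linear connection `c`. -/
def hlift {m n : ℕ}
    (c : EuclideanSpace ℝ (Fin m) →
      (EuclideanSpace ℝ (Fin m) →L[ℝ]
        (EuclideanSpace ℂ (Fin n) →L[ℂ] EuclideanSpace ℂ (Fin n))))
    (X : EuclideanSpace ℝ (Fin m) → EuclideanSpace ℝ (Fin m)) :
    EuclideanSpace ℝ (Fin m) × EuclideanSpace ℂ (Fin n) →
      EuclideanSpace ℝ (Fin m) × EuclideanSpace ℂ (Fin n) :=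
  fun p => (X p.1, c p.1 (X p.1) p.2)

theorem HasFDerivAt.prodMk_fst_clm_apply_snd {E F G H : Type*}
    [NormedAddCommGroup E] [NormedSpace ℝ E] [NormedAddCommGroup F] [NormedSpace ℝ F]
    [NormedAddCommGroup G] [NormedSpace ℝ G] [NormedAddCommGroup H] [NormedSpace ℝ H]
    {f : E → G} {f' : E →L[ℝ] G} {A : E → F →L[ℝ] H} {A' : E →L[ℝ] F →L[ℝ] H} {x : E}
    (hf : HasFDerivAt f f' x) (hA : HasFDerivAt A A' x) (u : F) :
    HasFDerivAt (fun p : E × F => (f p.1, A p.1 p.2))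
      ((f' ∘L ContinuousLinearMap.fst ℝ E F).prod
        (A x ∘L ContinuousLinearMap.snd ℝ E F +
          (A' ∘L ContinuousLinearMap.fst ℝ E F).flip u)) (x, u) := by
  have hfst : HasFDerivAt (Prod.fst : E × F → E) (ContinuousLinearMap.fst ℝ E F) (x, u) :=
    hasFDerivAt_fst
  exact (HasFDerivAt.comp (x, u) hf hfst).prodMk
    ((HasFDerivAt.comp (x, u) hA hfst).clm_apply hasFDerivAt_snd)

theorem fderiv_hlift_apply {m n : ℕ}
    {c : EuclideanSpace ℝ (Fin m) →
      (EuclideanSpace ℝ (Fin m) →L[ℝ]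
        (EuclideanSpace ℂ (Fin n) →L[ℂ] EuclideanSpace ℂ (Fin n)))}
    {X : EuclideanSpace ℝ (Fin m) → EuclideanSpace ℝ (Fin m)} {x : EuclideanSpace ℝ (Fin m)}
    (hc : DifferentiableAt ℝ c x) (hX : DifferentiableAt ℝ X x) (u : EuclideanSpace ℂ (Fin n))
    (v : EuclideanSpace ℝ (Fin m)) (w : EuclideanSpace ℂ (Fin n)) :
    fderiv ℝ (hlift c X) (x, u) (v, w) =
      (fderiv ℝ X x v, fderiv ℝ c x v (X x) u + c x (fderiv ℝ X x v) u + c x (X x) w) := by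
  have hA : HasFDerivAt (fun y => (c y (X y)).restrictScalars ℝ) _ x :=
    (ContinuousLinearMap.restrictScalarsL ℂ (EuclideanSpace ℂ (Fin n))
      (EuclideanSpace ℂ (Fin n)) ℝ ℝ).hasFDerivAt.comp x
        (hc.hasFDerivAt.clm_apply hX.hasFDerivAt)
  have h : HasFDerivAt (hlift c X) _ (x, u) := hX.hasFDerivAt.prodMk_fst_clm_apply_snd hA u
  rw [h.fderiv]
  simp only [ContinuousLinearMap.prod_apply, ContinuousLinearMap.comp_apply, add_apply,
    ContinuousLinearMap.flip_apply, ContinuousLinearMap.coe_fst', ContinuousLinearMap.coe_snd',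
    ContinuousLinearMap.coe_restrict_scalarsL', ContinuousLinearMap.coe_restrictScalars']
  congr 1
  abel

/-- The Lie bracket of horizontal lifts satisfies
`[Xᶜ, X'ᶜ](x, u) = ([X, X'] x, (c x ([X,X'] x) − R x (X x, X' x)) u)`:
the vertical defect from the horizontal lift of `[X, X']` is (minus) the curvature. -/
theorem bracket_of_horizontal_lifts {m n : ℕ}
    (Ω : Set (EuclideanSpace ℝ (Fin m))) (hΩ : IsOpen Ω)
    (c : EuclideanSpace ℝ (Fin m) →
      (EuclideanSpace ℝ (Fin m) →L[ℝ]
        (EuclideanSpace ℂ (Fin n) →L[ℂ] EuclideanSpace ℂ (Fin n))))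
    (hc : ContDiffOn ℝ (⊤ : ℕ∞) c Ω)
    (X X' : EuclideanSpace ℝ (Fin m) → EuclideanSpace ℝ (Fin m))
    (hX : ContDiffOn ℝ (⊤ : ℕ∞) X Ω) (hX' : ContDiffOn ℝ (⊤ : ℕ∞) X' Ω) :
    ∀ x ∈ Ω, ∀ u : EuclideanSpace ℂ (Fin n),
      fderiv ℝ (hlift c X') (x, u) (hlift c X (x, u))
          - fderiv ℝ (hlift c X) (x, u) (hlift c X' (x, u))
        = (fderiv ℝ X' x (X x) - fderiv ℝ X x (X' x),
           (c x (fderiv ℝ X' x (X x) - fderiv ℝ X x (X' x))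
             - curv c x (X x) (X' x)) u) := by
  intro x hx u
  have hΩx := hΩ.mem_nhds hx
  have hcx := (hc.contDiffAt hΩx).differentiableAt (by simp)
  have hXx := (hX.contDiffAt hΩx).differentiableAt (by simp)
  have hX'x := (hX'.contDiffAt hΩx).differentiableAt (by simp)
  simp only [hlift.eq_1 c X (x, u), hlift.eq_1 c X' (x, u), fderiv_hlift_apply hcx hXx,
    fderiv_hlift_apply hcx hX'x, Prod.mk_sub_mk, curv, map_sub, sub_apply,
    add_apply, neg_apply, ContinuousLinearMap.comp_apply]
  congr 1
  abel
end
end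

section
/- Let Ω ⊆ ℝ^m be open and c : Ω → L(ℝ^m, End_ℂ(ℂⁿ)) a smooth trivialized linear connection. On pairs (X, A) consisting of a smooth vector field X : Ω → ℝ^m and a smooth map A : Ω → End_ℂ(ℂⁿ), define the bracket [(X,A),(X',A')]_c := ( [X,X'] , x ↦ −R x (X x, X' x) + (∇_X A')(x) − (∇_{X'} A)(x) + [A' x, A x] ). Then this bracket satisfies the Jacobi identity: for any three smooth pairs (X₁,A₁), (X₂,A₂), (X₃,A₃), the cyclic sum [(X₁,A₁),[(X₂,A₂),(X₃,A₃)]_c]_c + [(X₂,A₂),[(X₃,A₃),(X₁,A₁)]_c]_c + [(X₃,A₃),[(X₁,A₁),(X₂,A₂)]_c]_c vanishes identically on Ω. -/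
noncomputable section

/-- The bracket `[(X, A), (X', A')]_c = ([X, X'], −R(X, X') + ∇_X A' − ∇_{X'} A + [A', A])`
on pairs consisting of a vector field and an `End`-valued coefficient. -/
def cbracket {m n : ℕ}
    (c : EuclideanSpace ℝ (Fin m) →
      (EuclideanSpace ℝ (Fin m) →L[ℝ]
        (EuclideanSpace ℂ (Fin n) →L[ℂ] EuclideanSpace ℂ (Fin n))))
    (P P' : (EuclideanSpace ℝ (Fin m) → EuclideanSpace ℝ (Fin m)) ×
      (EuclideanSpace ℝ (Fin m) →
        (EuclideanSpace ℂ (Fin n) →L[ℂ] EuclideanSpace ℂ (Fin n)))) :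
    (EuclideanSpace ℝ (Fin m) → EuclideanSpace ℝ (Fin m)) ×
      (EuclideanSpace ℝ (Fin m) →
        (EuclideanSpace ℂ (Fin n) →L[ℂ] EuclideanSpace ℂ (Fin n))) :=
  (fun x => fderiv ℝ P'.1 x (P.1 x) - fderiv ℝ P.1 x (P'.1 x),
   fun x => -(curv c x (P.1 x) (P'.1 x)) + covd c P.1 P'.2 x - covd c P'.1 P.2 x
     + ((P'.2 x).comp (P.2 x) - (P.2 x).comp (P'.2 x)))

section FlatBracket

variable {E 𝔸 : Type*} [NormedAddCommGroup E] [NormedSpace ℝ E]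
  [NormedRing 𝔸] [NormedSpace ℝ 𝔸] [IsScalarTower ℝ 𝔸 𝔸] [SMulCommClass ℝ 𝔸 𝔸]

/-- The algebra component of the bracket of pairs `(X, B)` for the trivial connection. -/
def flatBracket (X : E → E) (B : E → 𝔸) (X' : E → E) (B' : E → 𝔸) (x : E) : 𝔸 :=
  fderiv ℝ B' x (X x) - fderiv ℝ B x (X' x) + (B' x * B x - B x * B' x)

lemma hasFDerivAt_mul_of_isScalarTower {B B' : E → 𝔸} {x : E}
    (hB : DifferentiableAt ℝ B x) (hB' : DifferentiableAt ℝ B' x) :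
    HasFDerivAt (fun y => B y * B' y)
      ((ContinuousLinearMap.mul ℝ 𝔸).precompR E (B x) (fderiv ℝ B' x)
        + (ContinuousLinearMap.mul ℝ 𝔸).precompL E (fderiv ℝ B x) (B' x)) x :=
  (ContinuousLinearMap.mul ℝ 𝔸).hasFDerivAt_of_bilinear hB.hasFDerivAt hB'.hasFDerivAt

lemma exists_hasFDerivAt_flatBracket {X X' : E → E} {B B' : E → 𝔸} {x : E}
    (hX : ContDiffAt ℝ 2 X x) (hX' : ContDiffAt ℝ 2 X' x)
    (hB : ContDiffAt ℝ 2 B x) (hB' : ContDiffAt ℝ 2 B' x) :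
    ∃ L : E →L[ℝ] 𝔸, HasFDerivAt (flatBracket X B X' B') L x ∧ ∀ v, L v =
      fderiv ℝ (fderiv ℝ B') x v (X x) + fderiv ℝ B' x (fderiv ℝ X x v)
      - (fderiv ℝ (fderiv ℝ B) x v (X' x) + fderiv ℝ B x (fderiv ℝ X' x v))
      + ((B' x * fderiv ℝ B x v + fderiv ℝ B' x v * B x)
        - (B x * fderiv ℝ B' x v + fderiv ℝ B x v * B' x)) := by
  have dX := (hX.differentiableAt (by norm_num)).hasFDerivAt
  have dX' := (hX'.differentiableAt (by norm_num)).hasFDerivAt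
  have dB := hB.differentiableAt (by norm_num)
  have dB' := hB'.differentiableAt (by norm_num)
  have ddB := ((hB.fderiv_right (m := 1) (by norm_num)).differentiableAt
    (by norm_num)).hasFDerivAt
  have ddB' := ((hB'.fderiv_right (m := 1) (by norm_num)).differentiableAt
    (by norm_num)).hasFDerivAt
  have h := ((ddB'.clm_apply dX).sub (ddB.clm_apply dX')).add
    ((hasFDerivAt_mul_of_isScalarTower dB' dB).sub (hasFDerivAt_mul_of_isScalarTower dB dB'))
  refine ⟨_, h, fun v => ?_⟩
  simp
  abel

lemma differentiableAt_flatBracket {X X' : E → E} {B B' : E → 𝔸} {x : E}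
    (hX : ContDiffAt ℝ 2 X x) (hX' : ContDiffAt ℝ 2 X' x)
    (hB : ContDiffAt ℝ 2 B x) (hB' : ContDiffAt ℝ 2 B' x) :
    DifferentiableAt ℝ (flatBracket X B X' B') x :=
  let ⟨_, h, _⟩ := exists_hasFDerivAt_flatBracket hX hX' hB hB'
  h.differentiableAt

lemma fderiv_flatBracket_apply {X X' : E → E} {B B' : E → 𝔸} {x : E}
    (hX : ContDiffAt ℝ 2 X x) (hX' : ContDiffAt ℝ 2 X' x)
    (hB : ContDiffAt ℝ 2 B x) (hB' : ContDiffAt ℝ 2 B' x) (v : E) :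
    fderiv ℝ (flatBracket X B X' B') x v =
      fderiv ℝ (fderiv ℝ B') x v (X x) + fderiv ℝ B' x (fderiv ℝ X x v)
      - (fderiv ℝ (fderiv ℝ B) x v (X' x) + fderiv ℝ B x (fderiv ℝ X' x v))
      + ((B' x * fderiv ℝ B x v + fderiv ℝ B' x v * B x)
        - (B x * fderiv ℝ B' x v + fderiv ℝ B x v * B' x)) := by
  obtain ⟨L, h, hL⟩ := exists_hasFDerivAt_flatBracket hX hX' hB hB'
  rw [h.fderiv, hL]

/-- The Jacobi identity for the trivial connection. -/
lemma flatBracket_jacobi {X₁ X₂ X₃ : E → E} {B₁ B₂ B₃ : E → 𝔸} {x : E}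
    (hX₁ : ContDiffAt ℝ 2 X₁ x) (hX₂ : ContDiffAt ℝ 2 X₂ x) (hX₃ : ContDiffAt ℝ 2 X₃ x)
    (hB₁ : ContDiffAt ℝ 2 B₁ x) (hB₂ : ContDiffAt ℝ 2 B₂ x) (hB₃ : ContDiffAt ℝ 2 B₃ x) :
    flatBracket X₁ B₁ (VectorField.lieBracket ℝ X₂ X₃) (flatBracket X₂ B₂ X₃ B₃) x
      + flatBracket X₂ B₂ (VectorField.lieBracket ℝ X₃ X₁) (flatBracket X₃ B₃ X₁ B₁) x
      + flatBracket X₃ B₃ (VectorField.lieBracket ℝ X₁ X₂) (flatBracket X₁ B₁ X₂ B₂) x = 0 := by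
  have s₁ := (hB₁.isSymmSndFDerivAt (by simp)).eq (X₂ x) (X₃ x)
  have s₂ := (hB₂.isSymmSndFDerivAt (by simp)).eq (X₃ x) (X₁ x)
  have s₃ := (hB₃.isSymmSndFDerivAt (by simp)).eq (X₁ x) (X₂ x)
  simp only [flatBracket, fderiv_flatBracket_apply hX₂ hX₃ hB₂ hB₃,
    fderiv_flatBracket_apply hX₃ hX₁ hB₃ hB₁, fderiv_flatBracket_apply hX₁ hX₂ hB₁ hB₂,
    s₁, s₂, s₃, VectorField.lieBracket, map_sub]
  noncomm_ring

/-- The Jacobi identity for the Lie bracket of vector fields, as a cyclic sum. -/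
lemma lieBracket_jacobi [CompleteSpace E] {X₁ X₂ X₃ : E → E} {x : E}
    (h₁ : ContDiffAt ℝ 2 X₁ x) (h₂ : ContDiffAt ℝ 2 X₂ x) (h₃ : ContDiffAt ℝ 2 X₃ x) :
    VectorField.lieBracket ℝ X₁ (VectorField.lieBracket ℝ X₂ X₃) x
      + VectorField.lieBracket ℝ X₂ (VectorField.lieBracket ℝ X₃ X₁) x
      + VectorField.lieBracket ℝ X₃ (VectorField.lieBracket ℝ X₁ X₂) x = 0 := by
  have h := VectorField.leibniz_identity_lieBracket (n := 2) (by simp) h₁ h₂ h₃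
  have e₁ : VectorField.lieBracket ℝ X₃ X₁ = -VectorField.lieBracket ℝ X₁ X₃ :=
    funext fun _ => VectorField.lieBracket_swap
  rw [h, VectorField.lieBracket_swap (V := X₃) (W := VectorField.lieBracket ℝ X₁ X₂), e₁]
  simp only [VectorField.lieBracket_eq (V := X₂), fderiv_neg, Pi.neg_apply, map_neg, neg_apply]
  abel

end FlatBracket

lemma cbracket_fst {m n : ℕ}
    (c : EuclideanSpace ℝ (Fin m) →
      (EuclideanSpace ℝ (Fin m) →L[ℝ]
        (EuclideanSpace ℂ (Fin n) →L[ℂ] EuclideanSpace ℂ (Fin n))))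
    (P P' : (EuclideanSpace ℝ (Fin m) → EuclideanSpace ℝ (Fin m)) ×
      (EuclideanSpace ℝ (Fin m) →
        (EuclideanSpace ℂ (Fin n) →L[ℂ] EuclideanSpace ℂ (Fin n)))) :
    (cbracket c P P').1 = VectorField.lieBracket ℝ P.1 P'.1 := rfl

/-- The gauge change `A ↦ A + c(X)` carries the bracket `[·,·]_c` to the flat bracket. -/
lemma cbracket_snd_add {m n : ℕ}
    {c : EuclideanSpace ℝ (Fin m) →
      (EuclideanSpace ℝ (Fin m) →L[ℝ]
        (EuclideanSpace ℂ (Fin n) →L[ℂ] EuclideanSpace ℂ (Fin n)))}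
    {P P' : (EuclideanSpace ℝ (Fin m) → EuclideanSpace ℝ (Fin m)) ×
      (EuclideanSpace ℝ (Fin m) →
        (EuclideanSpace ℂ (Fin n) →L[ℂ] EuclideanSpace ℂ (Fin n)))}
    {x : EuclideanSpace ℝ (Fin m)} (hc : DifferentiableAt ℝ c x)
    (hX : DifferentiableAt ℝ P.1 x) (hA : DifferentiableAt ℝ P.2 x)
    (hX' : DifferentiableAt ℝ P'.1 x) (hA' : DifferentiableAt ℝ P'.2 x) :
    (cbracket c P P').2 x + c x ((cbracket c P P').1 x) =
      flatBracket P.1 (fun y => P.2 y + c y (P.1 y)) P'.1 (fun y => P'.2 y + c y (P'.1 y)) x := by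
  have h := (hA.hasFDerivAt.add (hc.hasFDerivAt.clm_apply hX.hasFDerivAt)).fderiv
  have h' := (hA'.hasFDerivAt.add (hc.hasFDerivAt.clm_apply hX'.hasFDerivAt)).fderiv
  simp only [Pi.add_def] at h h'
  simp only [flatBracket, cbracket, curv, covd, h, h', ← ContinuousLinearMap.mul_def,
    add_apply, ContinuousLinearMap.comp_apply,
    ContinuousLinearMap.flip_apply, map_sub]
  noncomm_ring

lemma cbracket_cbracket_snd_add {m n : ℕ}
    {c : EuclideanSpace ℝ (Fin m) →
      (EuclideanSpace ℝ (Fin m) →L[ℝ]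
        (EuclideanSpace ℂ (Fin n) →L[ℂ] EuclideanSpace ℂ (Fin n)))}
    {P₁ P₂ P₃ : (EuclideanSpace ℝ (Fin m) → EuclideanSpace ℝ (Fin m)) ×
      (EuclideanSpace ℝ (Fin m) →
        (EuclideanSpace ℂ (Fin n) →L[ℂ] EuclideanSpace ℂ (Fin n)))}
    {x : EuclideanSpace ℝ (Fin m)} (hc : ContDiffAt ℝ 2 c x)
    (h₁X : ContDiffAt ℝ 2 P₁.1 x) (h₁A : ContDiffAt ℝ 2 P₁.2 x)
    (h₂X : ContDiffAt ℝ 2 P₂.1 x) (h₂A : ContDiffAt ℝ 2 P₂.2 x)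
    (h₃X : ContDiffAt ℝ 2 P₃.1 x) (h₃A : ContDiffAt ℝ 2 P₃.2 x) :
    (cbracket c P₁ (cbracket c P₂ P₃)).2 x + c x ((cbracket c P₁ (cbracket c P₂ P₃)).1 x) =
      flatBracket P₁.1 (fun y => P₁.2 y + c y (P₁.1 y)) (VectorField.lieBracket ℝ P₂.1 P₃.1)
        (flatBracket P₂.1 (fun y => P₂.2 y + c y (P₂.1 y))
          P₃.1 (fun y => P₃.2 y + c y (P₃.1 y))) x := by
  have two_ne : (2 : WithTop ℕ∞) ≠ 0 := by norm_num
  have hev : (fun y => (cbracket c P₂ P₃).2 y + c y ((cbracket c P₂ P₃).1 y)) =ᶠ[nhds x]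
      flatBracket P₂.1 (fun y => P₂.2 y + c y (P₂.1 y))
        P₃.1 (fun y => P₃.2 y + c y (P₃.1 y)) := by
    filter_upwards [hc.eventually (by simp), h₂X.eventually (by simp), h₂A.eventually (by simp),
      h₃X.eventually (by simp), h₃A.eventually (by simp)] with y k k₂X k₂A k₃X k₃A
    exact cbracket_snd_add (k.differentiableAt two_ne) (k₂X.differentiableAt two_ne)
      (k₂A.differentiableAt two_ne) (k₃X.differentiableAt two_ne) (k₃A.differentiableAt two_ne)
  have fX : ContDiffAt ℝ 1 (cbracket c P₂ P₃).1 x :=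
    ((h₃X.fderiv_right (m := 1) (by norm_num)).clm_apply (h₂X.of_le one_le_two)).sub
      ((h₂X.fderiv_right (m := 1) (by norm_num)).clm_apply (h₃X.of_le one_le_two))
  have hcX := (hc.differentiableAt two_ne).clm_apply (fX.differentiableAt one_ne_zero)
  have hflat : DifferentiableAt ℝ (flatBracket P₂.1 (fun y => P₂.2 y + c y (P₂.1 y))
      P₃.1 (fun y => P₃.2 y + c y (P₃.1 y))) x :=
    differentiableAt_flatBracket h₂X h₃X (h₂A.add (hc.clm_apply h₂X))
      (h₃A.add (hc.clm_apply h₃X))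
  have hA : DifferentiableAt ℝ (cbracket c P₂ P₃).2 x := by
    simpa [Pi.sub_def] using (hflat.congr_of_eventuallyEq hev).sub hcX
  rw [cbracket_snd_add (hc.differentiableAt two_ne) (h₁X.differentiableAt two_ne)
    (h₁A.differentiableAt two_ne) (fX.differentiableAt one_ne_zero) hA]
  have hx := hev.eq_of_nhds
  beta_reduce at hx
  rw [← cbracket_fst c, flatBracket, hev.fderiv_eq, hx, ← flatBracket]

/-- The bracket `[·,·]_c` on pairs `(X, A)` satisfies the Jacobi identity on `Ω`. -/
theorem cbracket_jacobi {m n : ℕ}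
    (Ω : Set (EuclideanSpace ℝ (Fin m))) (hΩ : IsOpen Ω)
    (c : EuclideanSpace ℝ (Fin m) →
      (EuclideanSpace ℝ (Fin m) →L[ℝ]
        (EuclideanSpace ℂ (Fin n) →L[ℂ] EuclideanSpace ℂ (Fin n))))
    (hc : ContDiffOn ℝ (⊤ : ℕ∞) c Ω)
    (P₁ P₂ P₃ : (EuclideanSpace ℝ (Fin m) → EuclideanSpace ℝ (Fin m)) ×
      (EuclideanSpace ℝ (Fin m) →
        (EuclideanSpace ℂ (Fin n) →L[ℂ] EuclideanSpace ℂ (Fin n))))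
    (h₁X : ContDiffOn ℝ (⊤ : ℕ∞) P₁.1 Ω) (h₁A : ContDiffOn ℝ (⊤ : ℕ∞) P₁.2 Ω)
    (h₂X : ContDiffOn ℝ (⊤ : ℕ∞) P₂.1 Ω) (h₂A : ContDiffOn ℝ (⊤ : ℕ∞) P₂.2 Ω)
    (h₃X : ContDiffOn ℝ (⊤ : ℕ∞) P₃.1 Ω) (h₃A : ContDiffOn ℝ (⊤ : ℕ∞) P₃.2 Ω) :
    ∀ x ∈ Ω,
      (cbracket c P₁ (cbracket c P₂ P₃)).1 x
        + (cbracket c P₂ (cbracket c P₃ P₁)).1 x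
        + (cbracket c P₃ (cbracket c P₁ P₂)).1 x = 0
      ∧ (cbracket c P₁ (cbracket c P₂ P₃)).2 x
        + (cbracket c P₂ (cbracket c P₃ P₁)).2 x
        + (cbracket c P₃ (cbracket c P₁ P₂)).2 x = 0 := by
  intro x hx
  have hn : (2 : WithTop ℕ∞) ≤ (⊤ : ℕ∞) := WithTop.coe_le_coe.2 le_top
  have hΩx := hΩ.mem_nhds hx
  replace hc := (hc.contDiffAt hΩx).of_le hn
  replace h₁X := (h₁X.contDiffAt hΩx).of_le hn
  replace h₁A := (h₁A.contDiffAt hΩx).of_le hn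
  replace h₂X := (h₂X.contDiffAt hΩx).of_le hn
  replace h₂A := (h₂A.contDiffAt hΩx).of_le hn
  replace h₃X := (h₃X.contDiffAt hΩx).of_le hn
  replace h₃A := (h₃A.contDiffAt hΩx).of_le hn
  have hfst : (cbracket c P₁ (cbracket c P₂ P₃)).1 x + (cbracket c P₂ (cbracket c P₃ P₁)).1 x
      + (cbracket c P₃ (cbracket c P₁ P₂)).1 x = 0 := lieBracket_jacobi h₁X h₂X h₃X
  refine ⟨hfst, ?_⟩
  have hflat := flatBracket_jacobi h₁X h₂X h₃X (h₁A.add (hc.clm_apply h₁X))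
    (h₂A.add (hc.clm_apply h₂X)) (h₃A.add (hc.clm_apply h₃X))
  have hcfst := congrArg (c x) hfst
  simp only [map_add, map_zero] at hcfst
  rw [← hflat, ← sub_eq_zero]
  rw [← cbracket_cbracket_snd_add hc h₁X h₁A h₂X h₂A h₃X h₃A,
    ← cbracket_cbracket_snd_add hc h₂X h₂A h₃X h₃A h₁X h₁A,
    ← cbracket_cbracket_snd_add hc h₃X h₃A h₁X h₁A h₂X h₂A, ← neg_eq_zero, ← hcfst]
  abel
end
end

section
/- Let Ω ⊆ ℝ^m be open and c : Ω → L(ℝ^m, End_ℂ(ℂⁿ)) a smooth trivialized linear connection with curvature R x (v,w) = −(Dc(x)v)(w) + (Dc(x)w)(v) + c x v ∘ c x w − c x w ∘ c x v. Then the second Bianchi identity holds: for all constant directions v, w, z ∈ ℝ^m and every x ∈ Ω, (∇_v R(·,w,z))(x) + (∇_w R(·,z,v))(x) + (∇_z R(·,v,w))(x) = 0, where for a smooth End_ℂ(ℂⁿ)-valued map S on Ω one sets (∇_v S)(x) := DS(x)(v) − [c x v, S x]. -/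
noncomputable section

/-- The covariant derivative `(∇_v S)(x) = DS(x)(v) − [c x v, S x]` of a smooth
`End`-valued map along a constant direction `v`. -/
def covdDir {m n : ℕ}
    (c : EuclideanSpace ℝ (Fin m) →
      (EuclideanSpace ℝ (Fin m) →L[ℝ]
        (EuclideanSpace ℂ (Fin n) →L[ℂ] EuclideanSpace ℂ (Fin n))))
    (v : EuclideanSpace ℝ (Fin m))
    (S : EuclideanSpace ℝ (Fin m) →
      (EuclideanSpace ℂ (Fin n) →L[ℂ] EuclideanSpace ℂ (Fin n)))
    (x : EuclideanSpace ℝ (Fin m)) :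
    EuclideanSpace ℂ (Fin n) →L[ℂ] EuclideanSpace ℂ (Fin n) :=
  fderiv ℝ S x v - ((c x v).comp (S x) - (S x).comp (c x v))

section BilinearCurvature

variable {V F : Type*} [NormedAddCommGroup V] [NormedSpace ℝ V]
  [NormedAddCommGroup F] [NormedSpace ℝ F] (B : F →L[ℝ] F →L[ℝ] F)

/-- The directional derivative of the curvature `-d c + B (c, c)` of a one-form `c` valued in a
space with a continuous bilinear product `B`. -/
theorem fderiv_bilinear_curvature_apply {c : V → V →L[ℝ] F} {x : V}
    (hc : DifferentiableAt ℝ c x) (hc' : DifferentiableAt ℝ (fderiv ℝ c) x) (v w z : V) :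
    fderiv ℝ (fun y => -(fderiv ℝ c y w z) + fderiv ℝ c y z w
        + B (c y w) (c y z) - B (c y z) (c y w)) x v =
      -(fderiv ℝ (fderiv ℝ c) x v w z) + fderiv ℝ (fderiv ℝ c) x v z w
        + (B (c x w) (fderiv ℝ c x v z) + B (fderiv ℝ c x v w) (c x z))
        - (B (c x z) (fderiv ℝ c x v w) + B (fderiv ℝ c x v z) (c x w)) := by
  have h1 (u : V) := hc.hasFDerivAt.clm_apply (hasFDerivAt_const u x)
  have h2 (a b : V) :=
    (hc'.hasFDerivAt.clm_apply (hasFDerivAt_const a x)).clm_apply (hasFDerivAt_const b x)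
  have h3 (a b : V) := B.hasFDerivAt_of_bilinear (h1 a) (h1 b)
  have h := (((h2 w z).neg.add (h2 z w)).add (h3 w z)).sub (h3 z w)
  refine (DFunLike.congr_fun h.fderiv v).trans ?_
  simp

/-- The second Bianchi identity for a one-form valued in a space with an associative continuous
bilinear product `B`. -/
theorem bilinear_second_bianchi_identity (hB : ∀ a b d, B (B a b) d = B a (B b d))
    {c : V → V →L[ℝ] F} {x : V} (hc : ContDiffAt ℝ 2 c x) (R : V → V → V → F)
    (hR : ∀ y v w, R y v w =
      -(fderiv ℝ c y v w) + fderiv ℝ c y w v + B (c y v) (c y w) - B (c y w) (c y v))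
    (v w z : V) :
    (fderiv ℝ (fun y => R y w z) x v - (B (c x v) (R x w z) - B (R x w z) (c x v)))
      + (fderiv ℝ (fun y => R y z v) x w - (B (c x w) (R x z v) - B (R x z v) (c x w)))
      + (fderiv ℝ (fun y => R y v w) x z - (B (c x z) (R x v w) - B (R x v w) (c x z))) = 0 := by
  have hd : DifferentiableAt ℝ c x := hc.differentiableAt (by simp)
  have hd' : DifferentiableAt ℝ (fderiv ℝ c) x :=
    (hc.fderiv_right (m := 1) (by norm_num)).differentiableAt (by simp)
  have hs : IsSymmSndFDerivAt ℝ c x := hc.isSymmSndFDerivAt (by simp)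
  simp only [hR, fderiv_bilinear_curvature_apply B hd hd']
  rw [hs.eq w v, hs.eq z v, hs.eq z w]
  simp only [map_add, map_sub, map_neg, add_apply, sub_apply, neg_apply, hB]
  abel

end BilinearCurvature

/-- The second Bianchi identity for the curvature of a smooth trivialized linear
connection: `(∇_v R(·,w,z))(x) + (∇_w R(·,z,v))(x) + (∇_z R(·,v,w))(x) = 0`
for all constant directions `v, w, z` and every `x ∈ Ω`. -/
theorem second_bianchi_identity {m n : ℕ}
    (Ω : Set (EuclideanSpace ℝ (Fin m))) (hΩ : IsOpen Ω)
    (c : EuclideanSpace ℝ (Fin m) →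
      (EuclideanSpace ℝ (Fin m) →L[ℝ]
        (EuclideanSpace ℂ (Fin n) →L[ℂ] EuclideanSpace ℂ (Fin n))))
    (hc : ContDiffOn ℝ (⊤ : ℕ∞) c Ω) :
    ∀ x ∈ Ω, ∀ v w z : EuclideanSpace ℝ (Fin m),
      covdDir c v (fun y => curv c y w z) x
        + covdDir c w (fun y => curv c y z v) x
        + covdDir c z (fun y => curv c y v w) x = 0 := by
  intro x hx v w z
  have hcx : ContDiffAt ℝ 2 c x :=
    (hc.contDiffAt (hΩ.mem_nhds hx)).of_le (WithTop.coe_le_coe.2 le_top)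
  exact bilinear_second_bianchi_identity
    ((ContinuousLinearMap.compL ℂ (EuclideanSpace ℂ (Fin n)) (EuclideanSpace ℂ (Fin n))
      (EuclideanSpace ℂ (Fin n))).bilinearRestrictScalars ℝ)
    (fun _ _ _ => rfl) hcx (curv c) (fun _ _ _ => rfl) v w z
end
end
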